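/- Let −1 < α₁ < α₂ < −1/2 and set α₃ := −α₂, α₄ := −α₁. Let H := ℂA₁ ⊕ ℂA₂ ⊕ ℂA₃ ⊕ ℂA₄ with real form H_ℝ determined by the conditions Ā₁ = A₄, Ā₂ = A₃ (i.e. H_ℝ = ℝB₁ ⊕ ℝB₂ ⊕ ℝB₃ ⊕ ℝB₄ with A₁ = B₁ + iB₄ and A₂ = B₂ + iB₃). Let γ₁ := −(1/(4π))·Γ(α₁+1)·Γ(α₄) and γ₂ := −(1/(4π))·Γ(α₂+1)·Γ(α₃), and let S be the antisymmetric bilinear form on H with S(A₁,A₄) = 2iγ₁, S(A₂,A₃) = 2iγ₂, S(A₄,A₁) = −2iγ₁, S(A₃,A₂) = −2iγ₂, and S(A_j,A_k) = 0 otherwise. Then the filtration 0 = F¹ ⊂ F⁰ := ℂA₁ ⊕ ℂA₂ ⊂ F^{−1} := H is a pure Hodge structure of weight −1 on (H, H_ℝ) polarized by S, with H^{0,−1} = ℂA₁ ⊕ ℂA₂ and H^{−1,0} = ℂA₃ ⊕ ℂA₄; explicitly, for every nonzero v = aA₁ + bA₂ one has i·S(v, v̄) = (|a|²·Γ(α₁+1)·Γ(α₄)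 + |b|²·Γ(α₂+1)·Γ(α₃))/(2π) > 0. -/

import Mathlib

open Complex

noncomputable section

variable {H : Type*} [AddCommGroup H] [Module ℂ H]

/-- The Hodge component `H^{p,q} = F^p ∩ conj(F^q)`. -/
def HodgeComp (σ : H →ₗ⋆[ℂ] H) (F : ℤ → Submodule ℂ H) (p q : ℤ) : Submodule ℂ H :=
  F p ⊓ (F q).map σ

/-- A pure Hodge structure of weight `w`. -/
structure IsPureHS (σ : H →ₗ⋆[ℂ] H) (F : ℤ → Submodule ℂ H) (w : ℤ) : Prop where
  antitone : Antitone F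
  internal : DirectSum.IsInternal fun p : ℤ => HodgeComp σ F p (w - p)

/-- A pure Hodge structure of weight `w` polarized by `S`. -/
structure IsPolarizedPureHS (σ : H →ₗ⋆[ℂ] H) (F : ℤ → Submodule ℂ H) (w : ℤ)
    (S : H →ₗ[ℂ] H →ₗ[ℂ] ℂ) : Prop where
  pure : IsPureHS σ F w
  nondeg : ∀ x, (∀ y, S x y = 0) → x = 0
  symm : ∀ x y, S x y = (-1 : ℂ) ^ w * S y x
  real_on_real : ∀ x y, σ x = x → σ y = y → (S x y).im = 0
  orth : ∀ p : ℤ, ∀ x ∈ F p, ∀ y ∈ F (w + 1 - p), S x y = 0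
  positive : ∀ p q : ℤ, p + q = w → ∀ v ∈ HodgeComp σ F p q, v ≠ 0 →
    0 < (Complex.I ^ (p - q) * S v (σ v)).re ∧ (Complex.I ^ (p - q) * S v (σ v)).im = 0

/-- `H = ℂA₁ ⊕ ℂA₂ ⊕ ℂA₃ ⊕ ℂA₄`, with `A_j` the `(j-1)`-st standard basis vector. -/
abbrev H4 := Fin 4 → ℂ

/-- The conjugation with `Ā₁ = A₄` and `Ā₂ = A₃` (real form `ℝB₁ ⊕ ⋯ ⊕ ℝB₄` with
`A₁ = B₁ + iB₄` and `A₂ = B₂ + iB₃`). -/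
def conj4 : H4 →ₗ⋆[ℂ] H4 where
  toFun v := fun j => starRingEnd ℂ (v (3 - j))
  map_add' v w := by funext j; simp
  map_smul' c v := by funext j; simp

def A1 : H4 := ![1, 0, 0, 0]
def A2 : H4 := ![0, 1, 0, 0]
def A3 : H4 := ![0, 0, 1, 0]
def A4 : H4 := ![0, 0, 0, 1]

/-- `γ₁ = -(1/(4π))·Γ(α₁+1)·Γ(α₄)`. -/
def gam1 (a1 a4 : ℝ) : ℂ :=
  -(1 / (4 * (Real.pi : ℂ))) * (Real.Gamma (a1 + 1) : ℂ) * (Real.Gamma a4 : ℂ)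

/-- `γ₂ = -(1/(4π))·Γ(α₂+1)·Γ(α₃)`. -/
def gam2 (a2 a3 : ℝ) : ℂ :=
  -(1 / (4 * (Real.pi : ℂ))) * (Real.Gamma (a2 + 1) : ℂ) * (Real.Gamma a3 : ℂ)

/-- The antisymmetric pairing with `S(A₁,A₄) = 2iγ₁`, `S(A₂,A₃) = 2iγ₂`,
`S(A₄,A₁) = -2iγ₁`, `S(A₃,A₂) = -2iγ₂` and `0` otherwise. -/
def S4 (a1 a2 a3 a4 : ℝ) : H4 →ₗ[ℂ] H4 →ₗ[ℂ] ℂ :=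
  LinearMap.mk₂ ℂ
    (fun v w => 2 * Complex.I * gam1 a1 a4 * (v 0 * w 3 - v 3 * w 0)
      + 2 * Complex.I * gam2 a2 a3 * (v 1 * w 2 - v 2 * w 1))
    (fun v v' w => by simp; ring)
    (fun c v w => by simp; ring)
    (fun v w w' => by simp; ring)
    (fun c v w => by simp; ring)

/-- The filtration `0 = F¹ ⊂ F⁰ = ℂA₁ ⊕ ℂA₂ ⊂ F^{-1} = H`. -/
def F4 : ℤ → Submodule ℂ H4 := fun p =>
  if 1 ≤ p then ⊥ else if 0 ≤ p then Submodule.span ℂ {A1, A2} else ⊤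

lemma conj4_apply (v : H4) (j : Fin 4) : conj4 v j = starRingEnd ℂ (v (3 - j)) := rfl

lemma conj4_conj4 (v : H4) : conj4 (conj4 v) = v := by
  funext j
  simp [conj4_apply]

lemma mem_map_conj4 (P : Submodule ℂ H4) (v : H4) : v ∈ P.map conj4 ↔ conj4 v ∈ P := by
  constructor
  · rintro ⟨w, hw, rfl⟩
    rwa [conj4_conj4]
  · exact fun h => ⟨_, h, conj4_conj4 v⟩

lemma map_conj4_top : (⊤ : Submodule ℂ H4).map conj4 = ⊤ := by
  ext v
  simp only [mem_map_conj4, Submodule.mem_top]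

lemma mem_span_A1_A2 (v : H4) : v ∈ Submodule.span ℂ {A1, A2} ↔ v 2 = 0 ∧ v 3 = 0 := by
  rw [Submodule.mem_span_pair]
  constructor
  · rintro ⟨a, b, rfl⟩
    simp [A1, A2]
  · rintro ⟨h2, h3⟩
    refine ⟨v 0, v 1, ?_⟩
    funext j
    fin_cases j <;> simp [A1, A2, h2, h3]

lemma mem_span_A3_A4 (v : H4) : v ∈ Submodule.span ℂ {A3, A4} ↔ v 0 = 0 ∧ v 1 = 0 := by
  rw [Submodule.mem_span_pair]
  constructor
  · rintro ⟨a, b, rfl⟩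
    simp [A3, A4]
  · rintro ⟨h0, h1⟩
    refine ⟨v 2, v 3, ?_⟩
    funext j
    fin_cases j <;> simp [A3, A4, h0, h1]

lemma F4_of_one_le {p : ℤ} (hp : 1 ≤ p) : F4 p = ⊥ := by simp [F4, hp]

lemma F4_zero : F4 0 = Submodule.span ℂ {A1, A2} := by simp [F4]

lemma F4_of_neg {p : ℤ} (hp : p < 0) : F4 p = ⊤ := by
  simp [F4, show ¬ 1 ≤ p by lia, show ¬ 0 ≤ p by lia]

lemma F4_antitone : Antitone F4 := by
  intro p q hpq
  rcases lt_trichotomy p 0 with hp | rfl | hp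
  · simp [F4_of_neg hp]
  · rcases hpq.eq_or_lt with rfl | hq
    · rfl
    · simp [F4_of_one_le hq]
  · simp [F4_of_one_le (show 1 ≤ q by lia)]

lemma HodgeComp_zero_neg_one :
    HodgeComp conj4 F4 0 (-1) = Submodule.span ℂ {A1, A2} := by
  rw [HodgeComp, F4_zero, F4_of_neg (by norm_num), map_conj4_top, inf_top_eq]

lemma HodgeComp_neg_one_zero :
    HodgeComp conj4 F4 (-1) 0 = Submodule.span ℂ {A3, A4} := by
  rw [HodgeComp, F4_zero, F4_of_neg (by norm_num), top_inf_eq]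
  ext v
  rw [mem_map_conj4, mem_span_A1_A2, mem_span_A3_A4]
  simp [conj4_apply, and_comm]

lemma HodgeComp_eq_bot {p q : ℤ} (hpq : p + q = -1) (h0 : p ≠ 0) (h1 : p ≠ -1) :
    HodgeComp conj4 F4 p q = ⊥ := by
  rcases le_or_gt 1 p with hp | hp
  · rw [HodgeComp, F4_of_one_le hp, bot_inf_eq]
  · rw [HodgeComp, F4_of_one_le (show 1 ≤ q by lia), Submodule.map_bot, inf_bot_eq]

lemma disjoint_span_A1_A2_span_A3_A4 :
    Disjoint (Submodule.span ℂ {A1, A2}) (Submodule.span ℂ {A3, A4}) := by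
  rw [Submodule.disjoint_def]
  intro v hv hw
  obtain ⟨h2, h3⟩ := (mem_span_A1_A2 v).1 hv
  obtain ⟨h0, h1⟩ := (mem_span_A3_A4 v).1 hw
  funext j
  fin_cases j <;> assumption

lemma span_A1_A2_sup_span_A3_A4 :
    Submodule.span ℂ {A1, A2} ⊔ Submodule.span ℂ {A3, A4} = ⊤ := by
  rw [eq_top_iff]
  intro v _
  refine Submodule.mem_sup.2 ⟨![v 0, v 1, 0, 0], ?_, ![0, 0, v 2, v 3], ?_, ?_⟩
  · simp [mem_span_A1_A2]
  · simp [mem_span_A3_A4]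
  · funext j
    fin_cases j <;> simp

lemma isInternal_HodgeComp :
    DirectSum.IsInternal fun p : ℤ => HodgeComp conj4 F4 p (-1 - p) := by
  rw [DirectSum.isInternal_submodule_iff_iSupIndep_and_iSup_eq_top]
  have hbot : ∀ p : ℤ, p ≠ 0 → p ≠ -1 → HodgeComp conj4 F4 p (-1 - p) = ⊥ :=
    fun p => HodgeComp_eq_bot (by ring)
  have h0 : HodgeComp conj4 F4 0 (-1 - 0) = Submodule.span ℂ {A1, A2} := by
    rw [sub_zero, HodgeComp_zero_neg_one]
  have h1 : HodgeComp conj4 F4 (-1) (-1 - -1) = Submodule.span ℂ {A3, A4} := by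
    rw [sub_self, HodgeComp_neg_one_zero]
  constructor
  · intro p
    by_cases hp0 : p = 0
    · subst hp0
      dsimp only
      rw [h0]
      refine disjoint_span_A1_A2_span_A3_A4.mono_right (iSup₂_le fun q hq => ?_)
      by_cases hq1 : q = -1
      · subst hq1
        exact h1.le
      · simp [hbot q hq hq1]
    by_cases hp1 : p = -1
    · subst hp1
      dsimp only
      rw [h1]
      refine disjoint_span_A1_A2_span_A3_A4.symm.mono_right (iSup₂_le fun q hq => ?_)
      by_cases hq0 : q = 0
      · subst hq0
        exact h0.le
      · simp [hbot q hq0 hq]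
    · simp [hbot p hp0 hp1]
  · rw [eq_top_iff, ← span_A1_A2_sup_span_A3_A4, ← h0, ← h1]
    exact sup_le (le_iSup (fun p : ℤ => HodgeComp conj4 F4 p (-1 - p)) 0)
      (le_iSup (fun p : ℤ => HodgeComp conj4 F4 p (-1 - p)) (-1))

lemma S4_apply (a1 a2 a3 a4 : ℝ) (v w : H4) :
    S4 a1 a2 a3 a4 v w = 2 * Complex.I * gam1 a1 a4 * (v 0 * w 3 - v 3 * w 0)
      + 2 * Complex.I * gam2 a2 a3 * (v 1 * w 2 - v 2 * w 1) := rfl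

lemma S4_apply_conj4 (a1 a2 a3 a4 : ℝ) (v : H4) :
    Complex.I * S4 a1 a2 a3 a4 v (conj4 v) =
      ((((normSq (v 0) - normSq (v 3)) * (Real.Gamma (a1 + 1) * Real.Gamma a4)
        + (normSq (v 1) - normSq (v 2)) * (Real.Gamma (a2 + 1) * Real.Gamma a3))
        / (2 * Real.pi) : ℝ) : ℂ) := by
  have hpi : (Real.pi : ℂ) ≠ 0 := by exact_mod_cast Real.pi_ne_zero
  simp only [S4_apply, conj4_apply, gam1, gam2, sub_self, sub_zero,
    show (3 : Fin 4) - 2 = 1 from rfl, show (3 : Fin 4) - 1 = 2 from rfl]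
  push_cast
  simp only [← mul_conj]
  field_simp
  ring_nf
  simp only [I_sq]
  ring

lemma weighted_normSq_pos {g h : ℝ} (hg : 0 < g) (hh : 0 < h) {a b : ℂ} (hab : a ≠ 0 ∨ b ≠ 0) :
    0 < (normSq a * g + normSq b * h) / (2 * Real.pi) := by
  refine div_pos ?_ Real.two_pi_pos
  rcases hab with ha | hb
  · exact add_pos_of_pos_of_nonneg (mul_pos (normSq_pos.2 ha) hg)
      (mul_nonneg (normSq_nonneg b) hh.le)
  · exact add_pos_of_nonneg_of_pos (mul_nonneg (normSq_nonneg a) hg.le)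
      (mul_pos (normSq_pos.2 hb) hh)

lemma isPolarizedPureHS_F4 (a1 a2 a3 a4 : ℝ)
    (h14 : 0 < Real.Gamma (a1 + 1) * Real.Gamma a4)
    (h23 : 0 < Real.Gamma (a2 + 1) * Real.Gamma a3) :
    IsPolarizedPureHS conj4 F4 (-1) (S4 a1 a2 a3 a4) where
  pure := ⟨F4_antitone, isInternal_HodgeComp⟩
  nondeg x hx := by
    have hg1 : gam1 a1 a4 ≠ 0 := by
      rw [gam1, mul_assoc]
      refine mul_ne_zero ?_ (by exact_mod_cast h14.ne')
      simp [Real.pi_ne_zero]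
    have hg2 : gam2 a2 a3 ≠ 0 := by
      rw [gam2, mul_assoc]
      refine mul_ne_zero ?_ (by exact_mod_cast h23.ne')
      simp [Real.pi_ne_zero]
    have e1 := hx A1
    have e2 := hx A2
    have e3 := hx A3
    have e4 := hx A4
    simp [S4_apply, A1, A2, A3, A4, hg1, hg2] at e1 e2 e3 e4
    funext j
    fin_cases j <;> assumption
  symm x y := by
    simp only [S4_apply, zpow_neg_one, inv_neg, inv_one]
    ring
  real_on_real x y hx hy := by
    have key : ∀ a b : ℂ, (I * (a * starRingEnd ℂ b - starRingEnd ℂ a * b)).im = 0 := by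
      intro a b
      simp
    have hS : S4 a1 a2 a3 a4 x y =
        ((-(Real.Gamma (a1 + 1) * Real.Gamma a4) / (2 * Real.pi) : ℝ) : ℂ)
            * (I * (x 0 * starRingEnd ℂ (y 0) - starRingEnd ℂ (x 0) * y 0))
          + ((-(Real.Gamma (a2 + 1) * Real.Gamma a3) / (2 * Real.pi) : ℝ) : ℂ)
            * (I * (x 1 * starRingEnd ℂ (y 1) - starRingEnd ℂ (x 1) * y 1)) := by
      have hpi : (Real.pi : ℂ) ≠ 0 := by exact_mod_cast Real.pi_ne_zero
      have x3 : starRingEnd ℂ (x 0) = x 3 := congrFun hx 3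
      have x2 : starRingEnd ℂ (x 1) = x 2 := congrFun hx 2
      have y3 : starRingEnd ℂ (y 0) = y 3 := congrFun hy 3
      have y2 : starRingEnd ℂ (y 1) = y 2 := congrFun hy 2
      rw [x3, x2, y3, y2, S4_apply, gam1, gam2]
      push_cast
      field_simp
      ring
    rw [hS, add_im, im_ofReal_mul, im_ofReal_mul, key, key]
    simp
  orth p x hx y hy := by
    rcases lt_trichotomy p 0 with hp | rfl | hp
    · rw [F4_of_one_le (by lia), Submodule.mem_bot] at hy
      simp [hy]
    · rw [neg_add_cancel, sub_zero, F4_zero, mem_span_A1_A2] at hy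
      rw [F4_zero, mem_span_A1_A2] at hx
      simp [S4_apply, hx, hy]
    · rw [F4_of_one_le hp, Submodule.mem_bot] at hx
      simp [hx]
  positive p q hpq v hv hne := by
    have hI := S4_apply_conj4 a1 a2 a3 a4 v
    by_cases hp0 : p = 0
    · obtain rfl : q = -1 := by lia
      subst hp0
      obtain ⟨h2, h3⟩ := (mem_span_A1_A2 v).1 (HodgeComp_zero_neg_one ▸ hv)
      have h01 : v 0 ≠ 0 ∨ v 1 ≠ 0 := by
        by_contra! h
        refine hne (funext fun j => ?_)
        fin_cases j <;> simp [h, h2, h3]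
      rw [zero_sub, neg_neg, zpow_one, hI, h2, h3, ofReal_re, ofReal_im]
      simpa using weighted_normSq_pos h14 h23 h01
    by_cases hp1 : p = -1
    · obtain rfl : q = 0 := by lia
      subst hp1
      obtain ⟨h0, h1⟩ := (mem_span_A3_A4 v).1 (HodgeComp_neg_one_zero ▸ hv)
      have h32 : v 3 ≠ 0 ∨ v 2 ≠ 0 := by
        by_contra! h
        refine hne (funext fun j => ?_)
        fin_cases j <;> simp [h, h0, h1]
      rw [sub_zero, zpow_neg_one, inv_I, neg_mul, hI, h0, h1, ← ofReal_neg, ofReal_re, ofReal_im]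
      refine ⟨?_, rfl⟩
      convert weighted_normSq_pos h14 h23 h32 using 1
      rw [map_zero]
      ring
    · rw [HodgeComp_eq_bot hpq hp0 hp1, Submodule.mem_bot] at hv
      exact absurd hv hne

/-- **The Hodge structure of the quadric-threefold example** ([HS3, Section 9.1]):
for `-1 < α₁ < α₂ < -1/2`, `α₃ = -α₂`, `α₄ = -α₁`, the filtration `F⁴` is a pure Hodge
structure of weight `-1` polarized by `S`, with `H^{0,-1} = ℂA₁ ⊕ ℂA₂` and
`H^{-1,0} = ℂA₃ ⊕ ℂA₄`; for every `v = aA₁ + bA₂` one has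
`i·S(v,v̄) = (|a|²Γ(α₁+1)Γ(α₄) + |b|²Γ(α₂+1)Γ(α₃))/(2π)`, positive for `v ≠ 0`. -/
theorem quadric_example_Hodge_structure (a1 a2 : ℝ)
    (ha : -1 < a1 ∧ a1 < a2 ∧ a2 < -(1/2 : ℝ)) (a3 a4 : ℝ)
    (ha3 : a3 = -a2) (ha4 : a4 = -a1) :
    IsPolarizedPureHS conj4 F4 (-1) (S4 a1 a2 a3 a4) ∧
    HodgeComp conj4 F4 0 (-1) = Submodule.span ℂ {A1, A2} ∧
    HodgeComp conj4 F4 (-1) 0 = Submodule.span ℂ {A3, A4} ∧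
    (∀ a b : ℂ,
      Complex.I * S4 a1 a2 a3 a4 (a • A1 + b • A2) (conj4 (a • A1 + b • A2))
        = (((Complex.normSq a * (Real.Gamma (a1 + 1) * Real.Gamma a4)
            + Complex.normSq b * (Real.Gamma (a2 + 1) * Real.Gamma a3)) / (2 * Real.pi) : ℝ) : ℂ)) ∧
    (∀ a b : ℂ, a • A1 + b • A2 ≠ 0 →
      0 < (Complex.normSq a * (Real.Gamma (a1 + 1) * Real.Gamma a4)
            + Complex.normSq b * (Real.Gamma (a2 + 1) * Real.Gamma a3)) / (2 * Real.pi)) := by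
  subst ha3 ha4
  obtain ⟨h1, h12, h2⟩ := ha
  have h14 : 0 < Real.Gamma (a1 + 1) * Real.Gamma (-a1) :=
    mul_pos (Real.Gamma_pos_of_pos (by linarith)) (Real.Gamma_pos_of_pos (by linarith))
  have h23 : 0 < Real.Gamma (a2 + 1) * Real.Gamma (-a2) :=
    mul_pos (Real.Gamma_pos_of_pos (by linarith)) (Real.Gamma_pos_of_pos (by linarith))
  refine ⟨isPolarizedPureHS_F4 a1 a2 (-a2) (-a1) h14 h23, HodgeComp_zero_neg_one,
    HodgeComp_neg_one_zero, fun a b => ?_, fun a b hab => weighted_normSq_pos h14 h23 ?_⟩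
  · rw [S4_apply_conj4]
    simp [A1, A2]
  · by_contra! h
    exact hab (by simp [h])
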